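/- Assume G and the subgraph G_I induced on the interior nodes are connected. Let γ ∈ ℂ_0^E and let ζ ∈ ℝ be such that the Dirichlet problem for (γ,q) is well-posed for every q ∈ ℂ_ζ^I. Let q ∈ ℂ_ζ^I satisfy Q(q,q) = ℂ^I and let δq ∈ ℂ^I. Then both of the following sets are finite: (i) {t ∈ ℂ : q + tδq ∈ ℂ_ζ^I and Q(q + tδq, q + tδq) ≠ ℂ^I}; (ii) {t ∈ ℂ : q + tδq ∈ ℂ_ζ^I and Q(q, q + tδq) ≠ ℂ^I}. -/

import Mathlib

/-!
Common setup: a finite graph whose vertex set is partitioned into boundary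
nodes `B` and interior nodes `I` (so the vertex set is `B ⊕ I`), with edge
set `E` and a fixed orientation given by maps `head tail : E → B ⊕ I`.
-/

open Matrix MeasureTheory

namespace DIP

noncomputable section

variable {B I E : Type*} [Fintype B] [Fintype I] [Fintype E]
  [DecidableEq B] [DecidableEq I] [DecidableEq E]

/-- Discrete gradient: `(∇u)(e) = u(head e) - u(tail e)`. -/
def grad (head tail : E → B ⊕ I) (u : B ⊕ I → ℂ) : E → ℂ :=
  fun e => u (head e) - u (tail e)

/-- Signed incidence matrix over a commutative ring `α`. -/
def incMat (α : Type*) [CommRing α] (head tail : E → B ⊕ I) : Matrix E (B ⊕ I) α :=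
  Matrix.of fun e v => (if v = head e then (1 : α) else 0) - (if v = tail e then (1 : α) else 0)

/-- Weighted graph Laplacian `L_γ = ∇ᵀ diag(γ) ∇`. -/
def lap (α : Type*) [CommRing α] (head tail : E → B ⊕ I) (γ : E → α) :
    Matrix (B ⊕ I) (B ⊕ I) α :=
  (incMat α head tail)ᵀ * Matrix.diagonal γ * incMat α head tail

/-- The `II` block of the weighted graph Laplacian. -/
def lapII (α : Type*) [CommRing α] (head tail : E → B ⊕ I) (γ : E → α) : Matrix I I α :=
  (lap α head tail γ).submatrix Sum.inr Sum.inr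

/-- The `IB` block of the weighted graph Laplacian. -/
def lapIB (α : Type*) [CommRing α] (head tail : E → B ⊕ I) (γ : E → α) : Matrix I B α :=
  (lap α head tail γ).submatrix Sum.inr Sum.inl

/-- The `BI` block of the weighted graph Laplacian. -/
def lapBI (α : Type*) [CommRing α] (head tail : E → B ⊕ I) (γ : E → α) : Matrix B I α :=
  (lap α head tail γ).submatrix Sum.inl Sum.inr

/-- The `BB` block of the weighted graph Laplacian. -/
def lapBB (α : Type*) [CommRing α] (head tail : E → B ⊕ I) (γ : E → α) : Matrix B B α :=
  (lap α head tail γ).submatrix Sum.inl Sum.inl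

/-- Dirichlet-to-Neumann map
`Λ_{γ,q} = (L_γ)_BB - (L_γ)_BI [(L_γ)_II + diag(q)]⁻¹ (L_γ)_IB`. -/
def dtn (head tail : E → B ⊕ I) (γ : E → ℂ) (q : I → ℂ) : Matrix B B ℂ :=
  lapBB ℂ head tail γ -
    lapBI ℂ head tail γ * (lapII ℂ head tail γ + Matrix.diagonal q)⁻¹ * lapIB ℂ head tail γ

/-- `u` is `(γ,q)`-harmonic: `(L_γ u)_I + q ⊙ u_I = 0`. -/
def Harmonic (head tail : E → B ⊕ I) (γ : E → ℂ) (q : I → ℂ) (u : B ⊕ I → ℂ) : Prop :=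
  ∀ i : I, (lap ℂ head tail γ).mulVec u (Sum.inr i) + q i * u (Sum.inr i) = 0

/-- The graph `G` is connected. -/
def Gconn (head tail : E → B ⊕ I) : Prop :=
  (SimpleGraph.fromRel fun v w : B ⊕ I => ∃ e, head e = v ∧ tail e = w).Connected

/-- The subgraph of `G` induced on the interior nodes is connected. -/
def GIconn (head tail : E → B ⊕ I) : Prop :=
  (SimpleGraph.fromRel fun i j : I => ∃ e, head e = Sum.inr i ∧ tail e = Sum.inr j).Connected

/-- `P(γ₁,γ₂)`: span of Hadamard products of gradients of harmonic functions. -/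
def Pspace (head tail : E → B ⊕ I) (γ₁ γ₂ : E → ℂ) : Submodule ℂ (E → ℂ) :=
  Submodule.span ℂ { w : E → ℂ | ∃ u v : B ⊕ I → ℂ,
    Harmonic head tail γ₁ 0 u ∧ Harmonic head tail γ₂ 0 v ∧
    w = fun e => grad head tail u e * grad head tail v e }

/-- `Q(q₁,q₂)`: span of Hadamard products of interior values of harmonic functions. -/
def Qspace (head tail : E → B ⊕ I) (γ : E → ℂ) (q₁ q₂ : I → ℂ) : Submodule ℂ (I → ℂ) :=
  Submodule.span ℂ { w : I → ℂ | ∃ u v : B ⊕ I → ℂ,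
    Harmonic head tail γ q₁ u ∧ Harmonic head tail γ q₂ v ∧
    w = fun i => u (Sum.inr i) * v (Sum.inr i) }

/-- The matrix `U(γ)` whose `i`-th column is the harmonic extension of the
standard basis vector `e_i ∈ ℂ^B`. -/
def Usol (head tail : E → B ⊕ I) (γ : E → ℂ) : Matrix (B ⊕ I) B ℂ :=
  Matrix.of (Sum.elim (fun b i => if b = i then (1 : ℂ) else 0)
    (fun j i => (-((lapII ℂ head tail γ)⁻¹ * lapIB ℂ head tail γ)) j i))

/-- The products-of-gradients matrix `F(γ₁,γ₂) ∈ ℂ^{|E| × |B|²}` whose column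
indexed by `(i,j)` is `(∇ U(γ₁))_{:,i} ⊙ (∇ U(γ₂))_{:,j}`. -/
def Fmat (head tail : E → B ⊕ I) (γ₁ γ₂ : E → ℂ) : Matrix E (B × B) ℂ :=
  Matrix.of fun e p =>
    grad head tail (fun v => Usol head tail γ₁ v p.1) e *
    grad head tail (fun v => Usol head tail γ₂ v p.2) e

/-- Smallest eigenvalue of a real symmetric matrix, as the minimum of its
Rayleigh quotient over the (Euclidean) unit sphere. -/
def lambdaMin (M : Matrix I I ℝ) : ℝ :=
  ⨅ x : { x : I → ℝ // ∑ i, x i ^ 2 = 1 }, (x : I → ℝ) ⬝ᵥ M.mulVec (x : I → ℝ)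


theorem polyspan {I K : Type*} [Fintype I] [Fintype K] [DecidableEq I]
    (f : K → I → Polynomial ℂ)
    (h : Submodule.span ℂ (Set.range fun k i => (f k i).eval 0) = ⊤) :
    { t : ℂ | Submodule.span ℂ (Set.range fun k i => (f k i).eval t) ≠ ⊤ }.Finite := by
  have h1 : ∀ i : I, ∃ c : K → ℂ, ∑ k, c k • (fun j => (f k j).eval 0) = (Pi.single i 1 : I → ℂ) := by
    intro i
    have : (Pi.single i 1 : I → ℂ) ∈ Submodule.span ℂ (Set.range fun k i => (f k i).eval 0) := by
      rw [h]; trivial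
    exact (Submodule.mem_span_range_iff_exists_fun ℂ).1 this
  choose c hc using h1
  let N : Matrix I I (Polynomial ℂ) := Matrix.of fun i j => ∑ k, Polynomial.C (c i k) * f k j
  have hN : ∀ t, N.det.eval t = (Matrix.of fun i j => ∑ k, c i k * (f k j).eval t).det := by
    intro t
    have := RingHom.map_det (Polynomial.evalRingHom t) N
    rw [Polynomial.coe_evalRingHom] at this
    rw [this]
    congr 1
    ext i j
    simp [N, Polynomial.eval_finset_sum]
  have h0 : N.det ≠ 0 := by
    intro h0
    have h2 := hN 0
    have h3 : (Matrix.of fun i j => ∑ k, c i k * (f k j).eval 0) = (1 : Matrix I I ℂ) := by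
      ext i j
      have := congrFun (hc i) j
      simp only [Finset.sum_apply, Pi.smul_apply, smul_eq_mul] at this
      rw [Matrix.of_apply, this, Matrix.one_apply, Pi.single_apply]
      simp [eq_comm]
    rw [h3, h0] at h2
    simp at h2
  refine (Polynomial.finite_setOf_isRoot h0).subset ?_
  intro t ht
  by_contra hr
  apply ht
  have hd : IsUnit (Matrix.of fun i j => ∑ k, c i k * (f k j).eval t).det := by
    rw [← hN]; exact isUnit_iff_ne_zero.2 hr
  set M := (Matrix.of fun i j => ∑ k, c i k * (f k j).eval t) with hM
  rw [eq_top_iff]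
  intro x _
  have hx : x = (x ᵥ* M⁻¹) ᵥ* M := by
    rw [Matrix.vecMul_vecMul, Matrix.nonsing_inv_mul _ hd, Matrix.vecMul_one]
  rw [hx]
  have : (x ᵥ* M⁻¹) ᵥ* M = ∑ i, (x ᵥ* M⁻¹) i • ∑ k, c i k • (fun j => (f k j).eval t) := by
    ext j
    simp [Matrix.vecMul, dotProduct, hM]
  rw [this]
  exact Submodule.sum_mem _ fun i _ => Submodule.smul_mem _ _ <|
    Submodule.sum_mem _ fun k _ => Submodule.smul_mem _ _ <| Submodule.subset_span ⟨k, rfl⟩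

/-- scaled interior solution -/
def col (head tail : E → B ⊕ I) (γ : E → ℂ) (q : I → ℂ) (a : B) (i : I) : ℂ :=
  ((lapII ℂ head tail γ + Matrix.diagonal q).adjugate * lapIB ℂ head tail γ) i a

theorem harm_iff (head tail : E → B ⊕ I) (γ : E → ℂ) (q : I → ℂ) (u : B ⊕ I → ℂ) :
    Harmonic head tail γ q u ↔
      (lapII ℂ head tail γ + Matrix.diagonal q) *ᵥ (fun i => u (Sum.inr i)) +
        lapIB ℂ head tail γ *ᵥ (fun b => u (Sum.inl b)) = 0 := by
  rw [funext_iff]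
  refine forall_congr' fun i => ?_
  rw [Matrix.add_mulVec]
  simp only [Pi.add_apply, Matrix.mulVec_diagonal, Pi.zero_apply]
  have : (lap ℂ head tail γ *ᵥ u) (Sum.inr i) =
      (lapII ℂ head tail γ *ᵥ (fun i => u (Sum.inr i))) i +
      (lapIB ℂ head tail γ *ᵥ (fun b => u (Sum.inl b))) i := by
    simp [Matrix.mulVec, dotProduct, Fintype.sum_sum_type, lapII, lapIB, add_comm]
  rw [this]
  constructor <;> intro h <;> rw [← h] <;> ring

theorem col_harm (head tail : E → B ⊕ I) (γ : E → ℂ) (q : I → ℂ) (a : B) :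
    ∃ u, Harmonic head tail γ q u ∧ ∀ i, u (Sum.inr i) = col head tail γ q a i := by
  refine ⟨Sum.elim (Pi.single a (-(lapII ℂ head tail γ + Matrix.diagonal q).det))
    (col head tail γ q a), ?_, fun i => rfl⟩
  rw [harm_iff]
  simp only [Sum.elim_inl, Sum.elim_inr]
  have h1 : (fun i => col head tail γ q a i) =
      ((lapII ℂ head tail γ + Matrix.diagonal q).adjugate * lapIB ℂ head tail γ) *ᵥ
        (Pi.single a 1) := by
    ext i; simp [col]
  have h2 : (fun b => (Pi.single a (-(lapII ℂ head tail γ + Matrix.diagonal q).det) : B → ℂ) b) =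
      (-(lapII ℂ head tail γ + Matrix.diagonal q).det) • (Pi.single a 1 : B → ℂ) := by
    ext b; simp [Pi.single_apply]
  rw [h1, h2, Matrix.mulVec_mulVec, ← Matrix.mul_assoc, Matrix.mul_adjugate, Matrix.mulVec_smul,
    Matrix.smul_mul, Matrix.one_mul, Matrix.smul_mulVec, neg_smul, add_neg_cancel]

theorem harm_col (head tail : E → B ⊕ I) (γ : E → ℂ) (q : I → ℂ)
    (hu : IsUnit (lapII ℂ head tail γ + Matrix.diagonal q)) (u : B ⊕ I → ℂ)
    (h : Harmonic head tail γ q u) :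
    ∃ c : B → ℂ, ∀ i, u (Sum.inr i) = ∑ a, c a * col head tail γ q a i := by
  rw [harm_iff] at h
  have hd : (lapII ℂ head tail γ + Matrix.diagonal q).det ≠ 0 :=
    ((Matrix.isUnit_iff_isUnit_det _).1 hu).ne_zero
  set M := lapII ℂ head tail γ + Matrix.diagonal q with hM
  refine ⟨fun a => -(M.det)⁻¹ * u (Sum.inl a), fun i => ?_⟩
  have h1 := congrArg (fun w => (M.adjugate *ᵥ w) i) h
  simp only [Matrix.mulVec_add, Matrix.mulVec_mulVec, Matrix.adjugate_mul, Matrix.smul_mulVec,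
    Matrix.one_mulVec, Matrix.mulVec_zero, Pi.add_apply, Pi.smul_apply, smul_eq_mul,
    Pi.zero_apply] at h1
  have h2 : ∑ a, -(M.det)⁻¹ * u (Sum.inl a) * col head tail γ q a i =
      -(M.det)⁻¹ * ((M.adjugate * lapIB ℂ head tail γ) *ᵥ fun b => u (Sum.inl b)) i := by
    simp only [Matrix.mulVec, dotProduct, Finset.mul_sum, col, ← hM]
    exact Finset.sum_congr rfl fun a _ => by ring
  rw [h2]
  field_simp
  linear_combination h1

theorem span_le_Q (head tail : E → B ⊕ I) (γ : E → ℂ) (q₁ q₂ : I → ℂ) :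
    Submodule.span ℂ (Set.range fun (p : B × B) i =>
      col head tail γ q₁ p.1 i * col head tail γ q₂ p.2 i) ≤ Qspace head tail γ q₁ q₂ := by
  rw [Submodule.span_le]
  rintro _ ⟨p, rfl⟩
  obtain ⟨u, hu, hu'⟩ := col_harm head tail γ q₁ p.1
  obtain ⟨v, hv, hv'⟩ := col_harm head tail γ q₂ p.2
  exact Submodule.subset_span ⟨u, v, hu, hv, by ext i; simp [hu', hv']⟩

theorem Q_le_span (head tail : E → B ⊕ I) (γ : E → ℂ) (q₁ q₂ : I → ℂ)
    (h1 : IsUnit (lapII ℂ head tail γ + Matrix.diagonal q₁))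
    (h2 : IsUnit (lapII ℂ head tail γ + Matrix.diagonal q₂)) :
    Qspace head tail γ q₁ q₂ ≤ Submodule.span ℂ (Set.range fun (p : B × B) i =>
      col head tail γ q₁ p.1 i * col head tail γ q₂ p.2 i) := by
  rw [Qspace, Submodule.span_le]
  rintro _ ⟨u, v, hu, hv, rfl⟩
  obtain ⟨c, hc⟩ := harm_col head tail γ q₁ h1 u hu
  obtain ⟨d, hd⟩ := harm_col head tail γ q₂ h2 v hv
  rw [SetLike.mem_coe, Submodule.mem_span_range_iff_exists_fun]
  refine ⟨fun p => c p.1 * d p.2, ?_⟩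
  ext i
  simp only [Finset.sum_apply, Pi.smul_apply, smul_eq_mul, hc, hd, Fintype.sum_prod_type,
    Finset.sum_mul_sum]
  exact Finset.sum_congr rfl fun a _ => Finset.sum_congr rfl fun b _ => by ring

/-- polynomial version of `col` along a line -/
def colp (head tail : E → B ⊕ I) (γ : E → ℂ) (q δq : I → ℂ) (a : B) (i : I) : Polynomial ℂ :=
  (((lapII ℂ head tail γ).map Polynomial.C + Matrix.diagonal
    (fun i => Polynomial.C (q i) + Polynomial.X * Polynomial.C (δq i))).adjugate *
    (lapIB ℂ head tail γ).map Polynomial.C) i a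

theorem colp_eval (head tail : E → B ⊕ I) (γ : E → ℂ) (q δq : I → ℂ) (a : B) (i : I) (t : ℂ) :
    (colp head tail γ q δq a i).eval t = col head tail γ (fun i => q i + t * δq i) a i := by
  have h := RingHom.map_adjugate (Polynomial.evalRingHom t)
    ((lapII ℂ head tail γ).map Polynomial.C + Matrix.diagonal
    (fun i => Polynomial.C (q i) + Polynomial.X * Polynomial.C (δq i)))
  have h2 : (Polynomial.evalRingHom t).mapMatrix ((lapII ℂ head tail γ).map Polynomial.C +
      Matrix.diagonal (fun i => Polynomial.C (q i) + Polynomial.X * Polynomial.C (δq i))) =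
      lapII ℂ head tail γ + Matrix.diagonal (fun i => q i + t * δq i) := by
    ext j k
    by_cases hjk : j = k
    · subst hjk; simp; ring
    · simp [hjk]
  rw [h2] at h
  simp only [col, colp, Matrix.mul_apply, Polynomial.eval_finset_sum, Polynomial.eval_mul, ← h]
  simp

/-- along any direction `δq` there are at most finitely many
`t ∈ ℂ` with `q + tδq ∈ ℂ_ζ^I` for which (i) `Q(q + tδq, q + tδq) ≠ ℂ^I`, or
(ii) `Q(q, q + tδq) ≠ ℂ^I`. -/
theorem finitely_many_bad_schroe [Nonempty B] (head tail : E → B ⊕ I)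
    (hG : Gconn head tail) (hGI : GIconn head tail)
    (γ : E → ℂ) (hγ : ∀ e, 0 < (γ e).re) (ζ : ℝ)
    (hwell : ∀ q : I → ℂ, (∀ i, ζ < (q i).re) →
      IsUnit (lapII ℂ head tail γ + Matrix.diagonal q))
    (q : I → ℂ) (hq : ∀ i, ζ < (q i).re) (hQ : Qspace head tail γ q q = ⊤)
    (δq : I → ℂ) :
    { t : ℂ | (∀ i, ζ < (q i + t * δq i).re) ∧
        Qspace head tail γ (fun i => q i + t * δq i) (fun i => q i + t * δq i) ≠ ⊤ }.Finite ∧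
    { t : ℂ | (∀ i, ζ < (q i + t * δq i).re) ∧
        Qspace head tail γ q (fun i => q i + t * δq i) ≠ ⊤ }.Finite := by
  have hU := hwell q hq
  have htop := eq_top_iff.2 (hQ.ge.trans (Q_le_span head tail γ q q hU hU))
  constructor
  · refine (polyspan (fun (p : B × B) i =>
      colp head tail γ q δq p.1 i * colp head tail γ q δq p.2 i) ?_).subset ?_
    · simpa [colp_eval] using htop
    · rintro t ⟨-, ht⟩ hs
      apply ht
      simp only [Polynomial.eval_mul, colp_eval] at hs
      exact eq_top_iff.2 (hs.ge.trans (span_le_Q ..))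
  · refine (polyspan (fun (p : B × B) i =>
      Polynomial.C (col head tail γ q p.1 i) * colp head tail γ q δq p.2 i) ?_).subset ?_
    · simpa [colp_eval] using htop
    · rintro t ⟨-, ht⟩ hs
      apply ht
      simp only [Polynomial.eval_mul, colp_eval, Polynomial.eval_C] at hs
      exact eq_top_iff.2 (hs.ge.trans (span_le_Q ..))

end

end DIP
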